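/- Let n ≥ 2 and, in ℬ_n, define τ_1 = ω_0 and τ_i = ω_{i−1}⋯ω_1ω_0ω_1⋯ω_{i−1} for 2 ≤ i ≤ n. Then τ_i² = 1 for all 1 ≤ i ≤ n, and τ_iτ_j = −τ_jτ_i for all i ≠ j. -/

import Mathlib

/-!
STATEMENT 13: for `n ≥ 2`, in `ℬₙ`, with `τ₁ = ω₀` and
`τᵢ = ω_{i−1}⋯ω₁ω₀ω₁⋯ω_{i−1}` for `2 ≤ i ≤ n`, we have `τᵢ² = 1` for all `i`
and `τᵢτⱼ = −τⱼτᵢ` for `i ≠ j`.  (0-based indexing: `tau n k` is `τ_{k+1}`.)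
-/

namespace Stmt13

inductive BRel (n : ℕ) : FreeAlgebra ℂ (Fin n) → FreeAlgebra ℂ (Fin n) → Prop
  | sq (i : Fin n) : BRel n (FreeAlgebra.ι ℂ i ^ 2) 1
  | braid (i j : Fin n) (h1 : 1 ≤ (i : ℕ)) (h2 : (j : ℕ) = (i : ℕ) + 1) :
      BRel n ((FreeAlgebra.ι ℂ i * FreeAlgebra.ι ℂ j) ^ 3) 1
  | far (i j : Fin n) (h : (i : ℕ) + 2 ≤ (j : ℕ) ∨ (j : ℕ) + 2 ≤ (i : ℕ)) :
      BRel n ((FreeAlgebra.ι ℂ i * FreeAlgebra.ι ℂ j) ^ 2) 1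
  | quat (h : 2 ≤ n) :
      BRel n ((FreeAlgebra.ι ℂ (⟨0, by omega⟩ : Fin n) *
        FreeAlgebra.ι ℂ (⟨1, by omega⟩ : Fin n)) ^ 4) (-1)

abbrev BAlg (n : ℕ) := RingQuot (BRel n)

/-- The image in `ℬₙ` of the generator `ω_k` (and `1` for out-of-range `k`). -/
noncomputable def ωb (n : ℕ) (k : ℕ) : BAlg n :=
  if h : k < n then RingQuot.mkAlgHom ℂ (BRel n) (FreeAlgebra.ι ℂ (⟨k, h⟩ : Fin n)) else 1

/-- `tau n k = τ_{k+1} = ω_k ⋯ ω₁ ω₀ ω₁ ⋯ ω_k`. -/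
noncomputable def tau (n : ℕ) : ℕ → BAlg n
  | 0 => ωb n 0
  | k + 1 => ωb n (k + 1) * tau n k * ωb n (k + 1)

section Involutions

variable {R : Type*} [Ring R] {a b x y : R}

theorem mul_cancel_of_mul_self_eq_one (ha : a * a = 1) (x : R) : a * (a * x) = x := by
  rw [← mul_assoc, ha, one_mul]

theorem conj_mul_self_eq_one (ha : a * a = 1) (hx : x * x = 1) :
    a * x * a * (a * x * a) = 1 := by
  simp only [mul_assoc, mul_cancel_of_mul_self_eq_one ha, mul_cancel_of_mul_self_eq_one hx, ha]

theorem commute_of_mul_sq_eq_one (ha : a * a = 1) (hb : b * b = 1) (h : (a * b) ^ 2 = 1) :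
    Commute a b := by
  have h' : a * b * (a * b) = 1 := by rw [← pow_two, h]
  calc a * b = a * b * (a * b) * (b * a) := by
        simp only [mul_assoc, mul_cancel_of_mul_self_eq_one hb, ha, mul_one]
    _ = b * a := by rw [h', one_mul]

theorem braid_of_mul_pow_three_eq_one (ha : a * a = 1) (hb : b * b = 1)
    (h : (a * b) ^ 3 = 1) : a * b * a = b * a * b := by
  calc a * b * a = (a * b) ^ 3 * (b * a * b) := by
        simp only [pow_succ, pow_zero, one_mul, mul_assoc, mul_cancel_of_mul_self_eq_one hb,
          mul_cancel_of_mul_self_eq_one ha, hb, mul_one]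
    _ = b * a * b := by rw [h, one_mul]

theorem anticomm_of_mul_sq_eq_neg_one (ha : a * a = 1) (hy : y * y = 1)
    (h : a * y * (a * y) = -1) : a * y = -(y * a) := by
  calc a * y = a * y * (a * y) * (y * a) := by
        simp only [mul_assoc, mul_cancel_of_mul_self_eq_one hy, ha, mul_one]
    _ = -(y * a) := by rw [h, neg_one_mul]

theorem anticomm_conj_right (h : Commute x a) (hxy : x * y = -(y * x)) :
    x * (a * y * a) = -(a * y * a * x) := by
  calc x * (a * y * a) = x * a * y * a := by simp only [mul_assoc]
    _ = a * (x * y) * a := by rw [h.eq]; simp only [mul_assoc]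
    _ = -(a * y * (x * a)) := by rw [hxy, mul_neg, neg_mul]; simp only [mul_assoc]
    _ = -(a * y * a * x) := by rw [h.eq]; simp only [mul_assoc]

theorem commute_conj_conj_of_braid (hab : a * b * a = b * a * b) (h : Commute b x) :
    Commute a (b * (a * x * a) * b) := by
  calc a * (b * (a * x * a) * b) = a * b * a * x * a * b := by simp only [mul_assoc]
    _ = b * a * (b * x) * a * b := by rw [hab]; simp only [mul_assoc]
    _ = b * a * x * (b * a * b) := by rw [h.eq]; simp only [mul_assoc]
    _ = b * (a * x * a) * b * a := by rw [← hab]; simp only [mul_assoc]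

end Involutions

section Relations

variable {n : ℕ}

theorem ωb_of_lt {k : ℕ} (h : k < n) :
    ωb n k = RingQuot.mkAlgHom ℂ (BRel n) (FreeAlgebra.ι ℂ (⟨k, h⟩ : Fin n)) :=
  dif_pos h

theorem ωb_mul_self (k : ℕ) : ωb n k * ωb n k = 1 := by
  by_cases h : k < n
  · simpa [ωb_of_lt h, pow_two] using RingQuot.mkAlgHom_rel ℂ (BRel.sq (⟨k, h⟩ : Fin n))
  · simp [ωb, h]

theorem ωb_commute {i j : ℕ} (hij : i + 2 ≤ j) : Commute (ωb n i) (ωb n j) := by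
  by_cases hj : j < n
  · have hi : i < n := by omega
    refine commute_of_mul_sq_eq_one (ωb_mul_self i) (ωb_mul_self j) ?_
    simpa [ωb_of_lt hi, ωb_of_lt hj] using
      RingQuot.mkAlgHom_rel ℂ (BRel.far (⟨i, hi⟩ : Fin n) ⟨j, hj⟩ (Or.inl hij))
  · simp [ωb, hj]

theorem ωb_braid {i : ℕ} (hi : 1 ≤ i) (hn : i + 1 < n) :
    ωb n i * ωb n (i + 1) * ωb n i = ωb n (i + 1) * ωb n i * ωb n (i + 1) := by
  have hi' : i < n := by omega
  refine braid_of_mul_pow_three_eq_one (ωb_mul_self i) (ωb_mul_self (i + 1)) ?_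
  simpa [ωb_of_lt hi', ωb_of_lt hn] using
    RingQuot.mkAlgHom_rel ℂ (BRel.braid (⟨i, hi'⟩ : Fin n) ⟨i + 1, hn⟩ hi rfl)

theorem ωb_zero_mul_ωb_one_pow_four (hn : 2 ≤ n) : (ωb n 0 * ωb n 1) ^ 4 = -1 := by
  simpa [ωb_of_lt (show 0 < n by omega), ωb_of_lt (show 1 < n by omega)] using
    RingQuot.mkAlgHom_rel ℂ (BRel.quat hn)

theorem tau_mul_self (k : ℕ) : tau n k * tau n k = 1 := by
  induction k with
  | zero => exact ωb_mul_self 0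
  | succ k ih => exact conj_mul_self_eq_one (ωb_mul_self (k + 1)) ih

theorem ωb_commute_tau_of_add_two_le {j k : ℕ} (h : k + 2 ≤ j) :
    Commute (ωb n j) (tau n k) := by
  induction k with
  | zero => exact (ωb_commute h).symm
  | succ k ih =>
    have hc : Commute (ωb n j) (ωb n (k + 1)) := (ωb_commute h).symm
    exact (hc.mul_right (ih (by omega))).mul_right hc

theorem ωb_commute_tau_of_lt {j k : ℕ} (hj : 1 ≤ j) (hjk : j < k) (hk : k < n) :
    Commute (ωb n j) (tau n k) := by
  induction k, hjk using Nat.le_induction with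
  | base =>
    obtain ⟨i, rfl⟩ := Nat.exists_eq_add_of_le' hj
    exact commute_conj_conj_of_braid (ωb_braid hj hk) (ωb_commute_tau_of_add_two_le le_rfl)
  | succ k hjk ih =>
    have hc : Commute (ωb n j) (ωb n (k + 1)) := ωb_commute (by omega)
    exact (hc.mul_right (ih (by omega))).mul_right hc

theorem tau_zero_anticomm {k : ℕ} (hk : 1 ≤ k) (hn : 2 ≤ n) :
    tau n 0 * tau n k = -(tau n k * tau n 0) := by
  induction k, hk using Nat.le_induction with
  | base =>
    refine anticomm_of_mul_sq_eq_neg_one (tau_mul_self 0) (tau_mul_self 1) ?_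
    rw [← ωb_zero_mul_ωb_one_pow_four hn]
    simp only [tau, pow_succ, pow_zero, one_mul, mul_assoc, zero_add]
  | succ k hk ih => exact anticomm_conj_right (ωb_commute (by omega)) ih

theorem tau_anticomm_of_lt {i j : ℕ} (hij : i < j) (hj : j < n) :
    tau n i * tau n j = -(tau n j * tau n i) := by
  induction i with
  | zero => exact tau_zero_anticomm hij (by omega)
  | succ i ih =>
    have hc : Commute (tau n j) (ωb n (i + 1)) :=
      (ωb_commute_tau_of_lt (by omega) hij hj).symm
    have h := anticomm_conj_right hc (neg_eq_iff_eq_neg.mp (ih (by omega)).symm)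
    exact neg_eq_iff_eq_neg.mp h.symm

end Relations

theorem tau_sq_one_and_anticomm (n : ℕ) (hn : 2 ≤ n) :
    (∀ i : Fin n, tau n (i : ℕ) ^ 2 = 1) ∧
    (∀ i j : Fin n, i ≠ j →
      tau n (i : ℕ) * tau n (j : ℕ) = -(tau n (j : ℕ) * tau n (i : ℕ))) := by
  refine ⟨fun i => by rw [pow_two, tau_mul_self], fun i j hij => ?_⟩
  rcases lt_or_gt_of_ne (Fin.val_ne_of_ne hij) with h | h
  · exact tau_anticomm_of_lt h j.isLt
  · exact neg_eq_iff_eq_neg.mp (tau_anticomm_of_lt h i.isLt).symm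

end Stmt13
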